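/- Let f : ℝ^d → ℝ^p be differentiable with ‖∇_x f(x)‖_F ≤ L for all x ∈ ℝ^d, let Q be a probability distribution on ℝ^d, and let D = (x_1, …, x_m) be drawn i.i.d. from Q with m ≥ 1. Then for every ε > 0, the probability (over D ∼ Q^m) that GC(f, Q) − ĜC(f, D) ≥ ε is at most exp(−2mε²/L⁴). -/

import Mathlib

open MeasureTheory ENNReal

/-- Squared Frobenius norm of the Jacobian of `f` at `x`: the sum over output
coordinates of the squared Euclidean norms of the coordinate gradients. -/
noncomputable def frobSq {d p : ℕ}
    (f : EuclideanSpace ℝ (Fin d) → EuclideanSpace ℝ (Fin p))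
    (x : EuclideanSpace ℝ (Fin d)) : ℝ :=
  ∑ j : Fin p, ‖gradient (fun y => f y j) x‖ ^ 2

/-- Geometric complexity of `f` with respect to the distribution `Q`. -/
noncomputable def GC {d p : ℕ}
    (f : EuclideanSpace ℝ (Fin d) → EuclideanSpace ℝ (Fin p))
    (Q : Measure (EuclideanSpace ℝ (Fin d))) : ℝ :=
  ∫ x, frobSq f x ∂Q

/-- Class mean of `f` under `Q`. -/
noncomputable def classMean {d p : ℕ}
    (f : EuclideanSpace ℝ (Fin d) → EuclideanSpace ℝ (Fin p))
    (Q : Measure (EuclideanSpace ℝ (Fin d))) : EuclideanSpace ℝ (Fin p) :=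
  ∫ x, f x ∂Q

/-- Class variance of `f` under `Q`. -/
noncomputable def classVar {d p : ℕ}
    (f : EuclideanSpace ℝ (Fin d) → EuclideanSpace ℝ (Fin p))
    (Q : Measure (EuclideanSpace ℝ (Fin d))) : ℝ :=
  ∫ x, ‖f x - classMean f Q‖ ^ 2 ∂Q

/-- Class-distance normalized variance of two distributions. -/
noncomputable def CDNV {d p : ℕ}
    (f : EuclideanSpace ℝ (Fin d) → EuclideanSpace ℝ (Fin p))
    (Qi Qj : Measure (EuclideanSpace ℝ (Fin d))) : ℝ :=
  (classVar f Qi + classVar f Qj) / (2 * ‖classMean f Qi - classMean f Qj‖ ^ 2)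

/-- `P` satisfies a Poincaré inequality with constant `c`: for every differentiable
scalar function `v`, `Var_v(P) ≤ c · E_P[‖∇ v‖²]`. -/
def SatisfiesPoincare {d : ℕ} (c : ℝ) (P : Measure (EuclideanSpace ℝ (Fin d))) : Prop :=
  ∀ v : EuclideanSpace ℝ (Fin d) → ℝ, Differentiable ℝ v →
    ∫ x, (v x - ∫ y, v y ∂P) ^ 2 ∂P ≤ c * ∫ x, ‖gradient v x‖ ^ 2 ∂P

/-- Empirical geometric complexity of `f` over the sample `D`. -/
noncomputable def empGC {d p m : ℕ}
    (f : EuclideanSpace ℝ (Fin d) → EuclideanSpace ℝ (Fin p))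
    (D : Fin m → EuclideanSpace ℝ (Fin d)) : ℝ :=
  (1 / m : ℝ) * ∑ i : Fin m, frobSq f (D i)

lemma frobSq_nonneg {d p : ℕ}
    (f : EuclideanSpace ℝ (Fin d) → EuclideanSpace ℝ (Fin p))
    (x : EuclideanSpace ℝ (Fin d)) : 0 ≤ frobSq f x :=
  Finset.sum_nonneg fun _ _ => sq_nonneg _

lemma measurable_frobSq {d p : ℕ}
    (f : EuclideanSpace ℝ (Fin d) → EuclideanSpace ℝ (Fin p)) :
    Measurable (frobSq f) := by
  refine Finset.measurable_fun_sum _ fun j _ => ?_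
  simp only [gradient, LinearIsometryEquiv.norm_map]
  exact (measurable_fderiv ℝ _).norm.pow_const 2

/-- **Hoeffding's inequality** for the lower deviation of the sample mean of a
bounded function under a product measure. -/
lemma measureReal_integral_sub_sampleMean_ge_le {α : Type*} [MeasurableSpace α] {m : ℕ}
    (hm : 1 ≤ m) (Q : Measure α) [IsProbabilityMeasure Q] {g : α → ℝ} (hg : Measurable g)
    {a b : ℝ} (hab : ∀ x, g x ∈ Set.Icc a b) {ε : ℝ} (hε : 0 ≤ ε) :
    (Measure.pi fun _ : Fin m => Q).real
        {D | ε ≤ ∫ x, g x ∂Q - (1 / m : ℝ) * ∑ i, g (D i)} ≤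
      Real.exp (-2 * m * ε ^ 2 / (b - a) ^ 2) := by
  have hm0 : (0 : ℝ) < m := by exact_mod_cast hm
  have hX : Measurable fun x => -(g x - ∫ y, g y ∂Q) := (hg.sub_const _).neg
  have hsub := (ProbabilityTheory.hasSubgaussianMGF_of_mem_Icc (μ := Q) hg.aemeasurable
    (ae_of_all _ hab)).neg
  have hind := ProbabilityTheory.iIndepFun_pi (μ := fun _ : Fin m => Q)
    (X := fun _ x => -(g x - ∫ y, g y ∂Q)) fun _ => hX.aemeasurable
  have hsubi : ∀ i ∈ (Finset.univ : Finset (Fin m)), ProbabilityTheory.HasSubgaussianMGF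
      (fun D : Fin m → α => -(g (D i) - ∫ y, g y ∂Q)) ((‖b - a‖₊ / 2) ^ 2)
      (Measure.pi fun _ : Fin m => Q) := fun i _ => by
    have hmp := measurePreserving_eval (fun _ : Fin m => Q) i
    refine ProbabilityTheory.HasSubgaussianMGF.of_map (Y := Function.eval i)
      (X := fun x => -(g x - ∫ y, g y ∂Q)) hmp.measurable.aemeasurable ?_
    rw [hmp.map_eq]
    exact hsub
  have key := ProbabilityTheory.HasSubgaussianMGF.measure_sum_ge_le_of_iIndepFun hind hsubi
    (mul_nonneg hm0.le hε)
  convert key using 2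
  · ext D
    have hsum : ∑ i, -(g (D i) - ∫ y, g y ∂Q) =
        m * (∫ x, g x ∂Q - (1 / m : ℝ) * ∑ i, g (D i)) := by
      simp only [neg_sub, Finset.sum_sub_distrib, Finset.sum_const, Finset.card_univ,
        Fintype.card_fin, nsmul_eq_mul]
      field_simp
    simp only [Set.mem_ofPred_eq, hsum, mul_le_mul_iff_right₀ hm0]
  · simp only [Finset.sum_const, Finset.card_univ, Fintype.card_fin, nsmul_eq_mul]
    push_cast
    rw [Real.norm_eq_abs, div_pow, sq_abs]
    rcases eq_or_ne (b - a) 0 with h | h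
    · simp [h]
    · field_simp

/-- McDiarmid-type concentration of the empirical geometric
complexity: `P_{D∼Q^m}[GC(f,Q) − ĜC(f,D) ≥ ε] ≤ exp(−2mε²/L⁴)`. -/
theorem empirical_gc_concentration {d p m : ℕ} (hm : 1 ≤ m)
    (Q : Measure (EuclideanSpace ℝ (Fin d))) [IsProbabilityMeasure Q]
    (f : EuclideanSpace ℝ (Fin d) → EuclideanSpace ℝ (Fin p))
    (hf : Differentiable ℝ f)
    (L : ℝ) (hL : ∀ x, Real.sqrt (frobSq f x) ≤ L)
    (ε : ℝ) (hε : 0 < ε) :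
    (Measure.pi fun _ : Fin m => Q)
        {D | GC f Q - empGC f D ≥ ε} ≤
      ENNReal.ofReal (Real.exp (-2 * m * ε ^ 2 / L ^ 4)) := by
  have hbound : ∀ x, frobSq f x ∈ Set.Icc 0 (L ^ 2) := fun x =>
    ⟨frobSq_nonneg f x, Real.sqrt_le_iff.mp (hL x) |>.2⟩
  have h := measureReal_integral_sub_sampleMean_ge_le hm Q (measurable_frobSq f) hbound hε.le
  rw [sub_zero, ← pow_mul] at h
  rw [← ofReal_measureReal]
  exact ENNReal.ofReal_le_ofReal h
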